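/- Let A be an n×n real symmetric matrix and let p ≥ 1 be a real number. Then for every n×n real symmetric matrix X one has ‖(AX + XA)/2‖ₚ ≤ ‖A‖_∞ · ‖X‖ₚ, and there exists a nonzero symmetric X for which equality holds; that is, the operator norm of the Lyapunov transformation L_A(X) := (AX + XA)/2 with respect to the spectral p-norm equals ‖A‖_∞. -/

import Mathlib

open Matrix

/-- The spectral `p`-norm of a symmetric/Hermitian matrix:
`‖X‖ₚ = (∑ i, |λᵢ(X)|^p)^(1/p)`. -/
noncomputable def spectralPNorm {n : ℕ} (p : ℝ) {X : Matrix (Fin n) (Fin n) ℝ}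
    (hX : X.IsHermitian) : ℝ :=
  (∑ i, |hX.eigenvalues i| ^ p) ^ (1 / p)

/-- The spectral `∞`-norm of a symmetric/Hermitian matrix: `‖X‖_∞ = maxᵢ |λᵢ(X)|`. -/
noncomputable def spectralSupNorm {n : ℕ} {X : Matrix (Fin n) (Fin n) ℝ}
    (hX : X.IsHermitian) : ℝ :=
  ⨆ i, |hX.eigenvalues i|

open scoped InnerProductSpace

/-- A nonnegative matrix whose row and column sums are at most `a` has `ℓᵖ` operator norm at most
`a` (the Schur test). -/
lemma sum_rpow_le_of_row_col_sum_le {ι κ : Type*} [Fintype ι] [Fintype κ] {p a : ℝ} (hp : 1 ≤ p)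
    (ha : 0 ≤ a) {M : ι → κ → ℝ} (hM : ∀ i j, 0 ≤ M i j) (hrow : ∀ i, ∑ j, M i j ≤ a)
    (hcol : ∀ j, ∑ i, M i j ≤ a) {x : κ → ℝ} (hx : ∀ j, 0 ≤ x j) :
    ∑ i, (∑ j, M i j * x j) ^ p ≤ a ^ p * ∑ j, x j ^ p := by
  have hp0 : 0 < p := by linarith
  have hp1 : 0 ≤ 1 - p⁻¹ := sub_nonneg.2 (inv_le_one_of_one_le₀ hp)
  have hxp : ∀ j, 0 ≤ x j ^ p := fun j => Real.rpow_nonneg (hx j) p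
  have hS : ∀ i, 0 ≤ ∑ j, M i j * x j ^ p := fun i =>
    Finset.sum_nonneg fun j _ => mul_nonneg (hM i j) (hxp j)
  have key : ∀ i, (∑ j, M i j * x j) ^ p ≤ a ^ (p - 1) * ∑ j, M i j * x j ^ p := by
    intro i
    have h0 : 0 ≤ ∑ j, M i j * x j := Finset.sum_nonneg fun j _ => mul_nonneg (hM i j) (hx j)
    have hholder : ∑ j, M i j * x j ≤ a ^ (1 - p⁻¹) * (∑ j, M i j * x j ^ p) ^ p⁻¹ :=
      (Real.inner_le_weight_mul_Lp_of_nonneg Finset.univ hp (M i) x (hM i) hx).trans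
        (mul_le_mul_of_nonneg_right
          (Real.rpow_le_rpow (Finset.sum_nonneg fun j _ => hM i j) (hrow i) hp1)
          (Real.rpow_nonneg (hS i) _))
    calc (∑ j, M i j * x j) ^ p
        ≤ (a ^ (1 - p⁻¹) * (∑ j, M i j * x j ^ p) ^ p⁻¹) ^ p :=
          Real.rpow_le_rpow h0 hholder hp0.le
      _ = a ^ (p - 1) * ∑ j, M i j * x j ^ p := by
          rw [Real.mul_rpow (Real.rpow_nonneg ha _) (Real.rpow_nonneg (hS i) _),
            ← Real.rpow_mul ha, ← Real.rpow_mul (hS i), inv_mul_cancel₀ hp0.ne', Real.rpow_one,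
            sub_mul, inv_mul_cancel₀ hp0.ne', one_mul]
  calc ∑ i, (∑ j, M i j * x j) ^ p
      ≤ ∑ i, a ^ (p - 1) * ∑ j, M i j * x j ^ p := Finset.sum_le_sum fun i _ => key i
    _ = a ^ (p - 1) * ∑ j, (∑ i, M i j) * x j ^ p := by
        rw [← Finset.mul_sum, Finset.sum_comm]
        simp_rw [Finset.sum_mul]
    _ ≤ a ^ (p - 1) * ∑ j, a * x j ^ p :=
        mul_le_mul_of_nonneg_left
          (Finset.sum_le_sum fun j _ => mul_le_mul_of_nonneg_right (hcol j) (hxp j))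
          (Real.rpow_nonneg ha _)
    _ = a ^ p * ∑ j, x j ^ p := by
        rw [← Finset.mul_sum, ← mul_assoc]
        congr 1
        have h := Real.rpow_add' ha (y := p - 1) (z := 1) (by linarith)
        rw [sub_add_cancel, Real.rpow_one] at h
        exact h.symm

lemma OrthonormalBasis.sum_abs_inner_mul_abs_inner_le {ι E : Type*} [Fintype ι]
    [NormedAddCommGroup E] [InnerProductSpace ℝ E] (b : OrthonormalBasis ι ℝ E) (x y : E) :
    ∑ i, |⟪b i, x⟫_ℝ| * |⟪b i, y⟫_ℝ| ≤ ‖x‖ * ‖y‖ := by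
  refine (Real.sum_mul_le_sqrt_mul_sqrt Finset.univ _ _).trans_eq ?_
  simp_rw [sq_abs, b.sum_sq_inner_right, Real.sqrt_sq (norm_nonneg _)]

namespace Matrix.IsHermitian

variable {n : ℕ} {A X Y : Matrix (Fin n) (Fin n) ℝ}

lemma toEuclideanLin_eigenvectorBasis (hA : A.IsHermitian) (j : Fin n) :
    toEuclideanLin A (hA.eigenvectorBasis j) = hA.eigenvalues j • hA.eigenvectorBasis j := by
  rw [toLpLin_apply, hA.mulVec_eigenvectorBasis]
  rfl

lemma inner_eigenvectorBasis_toEuclideanLin (hA : A.IsHermitian) (j : Fin n)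
    (v : EuclideanSpace ℝ (Fin n)) :
    ⟪hA.eigenvectorBasis j, toEuclideanLin A v⟫_ℝ =
      hA.eigenvalues j * ⟪hA.eigenvectorBasis j, v⟫_ℝ := by
  rw [← isSymmetric_toEuclideanLin_iff.mpr hA, hA.toEuclideanLin_eigenvectorBasis,
    real_inner_smul_left]

lemma abs_eigenvalues_le_spectralSupNorm (hA : A.IsHermitian) (i : Fin n) :
    |hA.eigenvalues i| ≤ spectralSupNorm hA :=
  le_ciSup (f := fun i => |hA.eigenvalues i|) (Set.finite_range _).bddAbove i

lemma spectralSupNorm_nonneg (hA : A.IsHermitian) : 0 ≤ spectralSupNorm hA :=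
  Real.iSup_nonneg fun _ => abs_nonneg _

lemma spectralPNorm_nonneg (hX : X.IsHermitian) (p : ℝ) : 0 ≤ spectralPNorm p hX :=
  Real.rpow_nonneg (Finset.sum_nonneg fun _ _ => Real.rpow_nonneg (abs_nonneg _) _) _

lemma norm_toEuclideanLin_le (hA : A.IsHermitian) (v : EuclideanSpace ℝ (Fin n)) :
    ‖toEuclideanLin A v‖ ≤ spectralSupNorm hA * ‖v‖ := by
  have h0 := hA.spectralSupNorm_nonneg
  refine le_of_sq_le_sq ?_ (by positivity)
  rw [mul_pow, ← hA.eigenvectorBasis.sum_sq_inner_right, ← hA.eigenvectorBasis.sum_sq_inner_right,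
    Finset.mul_sum]
  refine Finset.sum_le_sum fun j _ => ?_
  rw [hA.inner_eigenvectorBasis_toEuclideanLin, mul_pow]
  gcongr ?_ * _
  exact sq_le_sq' (neg_le_of_abs_le (hA.abs_eigenvalues_le_spectralSupNorm j))
    (le_of_abs_le (hA.abs_eigenvalues_le_spectralSupNorm j))

lemma eigenvalues_lyapunov (hA : A.IsHermitian) (hX : X.IsHermitian) (hY : Y.IsHermitian)
    (h : Y = (1 / 2 : ℝ) • (A * X + X * A)) (i : Fin n) :
    hY.eigenvalues i = ⟪toEuclideanLin A (hY.eigenvectorBasis i),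
      toEuclideanLin X (hY.eigenvectorBasis i)⟫_ℝ := by
  set v := hY.eigenvectorBasis i with hv
  have h1 : ⟪v, toEuclideanLin Y v⟫_ℝ = hY.eigenvalues i := by
    rw [hv, hY.inner_eigenvectorBasis_toEuclideanLin, real_inner_self_eq_norm_sq,
      hY.eigenvectorBasis.norm_eq_one]
    simp
  have h2 : toEuclideanLin Y v = (1 / 2 : ℝ) •
      (toEuclideanLin A (toEuclideanLin X v) + toEuclideanLin X (toEuclideanLin A v)) := by
    rw [h, map_smul, map_add, toLpLin_mul_same, toLpLin_mul_same]
    rfl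
  rw [← h1, h2, real_inner_smul_right, inner_add_right,
    ← isSymmetric_toEuclideanLin_iff.mpr hA v, ← isSymmetric_toEuclideanLin_iff.mpr hX v,
    real_inner_comm (toEuclideanLin A v) (toEuclideanLin X v)]
  ring

/-- If `A` is bounded by `a` on Euclidean space, then `L_A` is bounded by `a` in the spectral
`p`-norm. -/
lemma spectralPNorm_lyapunov_le (hA : A.IsHermitian) (hX : X.IsHermitian) (hY : Y.IsHermitian)
    (h : Y = (1 / 2 : ℝ) • (A * X + X * A)) {p a : ℝ} (hp : 1 ≤ p) (ha : 0 ≤ a)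
    (hbound : ∀ v, ‖toEuclideanLin A v‖ ≤ a * ‖v‖) :
    spectralPNorm p hY ≤ a * spectralPNorm p hX := by
  set v := hY.eigenvectorBasis
  set u := hX.eigenvectorBasis with hu
  let M : Fin n → Fin n → ℝ := fun i j => |⟪u j, toEuclideanLin A (v i)⟫_ℝ| * |⟪u j, v i⟫_ℝ|
  have hM : ∀ i j, 0 ≤ M i j := fun i j => by positivity
  have hrow : ∀ i, ∑ j, M i j ≤ a := fun i => by
    refine (u.sum_abs_inner_mul_abs_inner_le _ _).trans ?_
    simpa [v.norm_eq_one] using hbound (v i)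
  have hcol : ∀ j, ∑ i, M i j ≤ a := fun j => by
    have hj : ∑ i, M i j = ∑ i, |⟪v i, toEuclideanLin A (u j)⟫_ℝ| * |⟪v i, u j⟫_ℝ| := by
      refine Finset.sum_congr rfl fun i _ => ?_
      rw [← isSymmetric_toEuclideanLin_iff.mpr hA (v i) (u j),
        real_inner_comm (u j), real_inner_comm (u j)]
    rw [hj]
    refine (v.sum_abs_inner_mul_abs_inner_le _ _).trans ?_
    simpa [u.norm_eq_one] using hbound (u j)
  have hle : ∀ i, |hY.eigenvalues i| ≤ ∑ j, M i j * |hX.eigenvalues j| := fun i => by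
    rw [hA.eigenvalues_lyapunov hX hY h, ← u.sum_inner_mul_inner]
    refine (Finset.abs_sum_le_sum_abs _ _).trans_eq (Finset.sum_congr rfl fun j _ => ?_)
    rw [hu, hX.inner_eigenvectorBasis_toEuclideanLin, abs_mul, abs_mul,
      real_inner_comm (hX.eigenvectorBasis j)]
    ring
  have hp0 : 0 < p := by linarith
  have hsum : ∑ i, |hY.eigenvalues i| ^ p ≤ a ^ p * ∑ j, |hX.eigenvalues j| ^ p :=
    (Finset.sum_le_sum fun i _ => Real.rpow_le_rpow (abs_nonneg _) (hle i) hp0.le).trans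
      (sum_rpow_le_of_row_col_sum_le hp ha hM hrow hcol fun j => abs_nonneg _)
  calc spectralPNorm p hY ≤ (a ^ p * ∑ j, |hX.eigenvalues j| ^ p) ^ (1 / p) :=
        Real.rpow_le_rpow (Finset.sum_nonneg fun _ _ => Real.rpow_nonneg (abs_nonneg _) _) hsum
          (by positivity)
    _ = a * spectralPNorm p hX := by
        rw [Real.mul_rpow (Real.rpow_nonneg ha _)
          (Finset.sum_nonneg fun _ _ => Real.rpow_nonneg (abs_nonneg _) _), ← Real.rpow_mul ha,
          mul_one_div_cancel hp0.ne', Real.rpow_one, spectralPNorm]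

lemma abs_mul_spectralPNorm_le {c : ℝ} (hX : X.IsHermitian) (hY : Y.IsHermitian) (h : Y = c • X)
    {p : ℝ} (hp : 1 ≤ p) : |c| * spectralPNorm p hX ≤ spectralPNorm p hY := by
  rcases eq_or_ne c 0 with rfl | hc
  · simpa using hY.spectralPNorm_nonneg p
  have hC : (c⁻¹ • (1 : Matrix (Fin n) (Fin n) ℝ)).IsHermitian := by
    simp [Matrix.IsHermitian]
  have hXY : X = (1 / 2 : ℝ) • ((c⁻¹ • (1 : Matrix (Fin n) (Fin n) ℝ)) * Y + Y * (c⁻¹ • 1)) := by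
    rw [smul_mul_assoc, mul_smul_comm, one_mul, mul_one, h, inv_smul_smul₀ hc, ← two_smul ℝ X,
      smul_smul]
    norm_num
  have hle := hC.spectralPNorm_lyapunov_le hY hX hXY hp (abs_nonneg c⁻¹) fun v => by
    rw [map_smul, toLpLin_one, LinearMap.smul_apply, LinearMap.id_apply, norm_smul,
      Real.norm_eq_abs]
  rwa [abs_inv, inv_mul_eq_div, le_div_iff₀' (abs_pos.2 hc)] at hle

end Matrix.IsHermitian

/-- For a real symmetric `A` and `p ≥ 1`, the Lyapunov transformation
`L_A(X) = (AX + XA)/2` satisfies `‖L_A(X)‖ₚ ≤ ‖A‖_∞ ‖X‖ₚ` for all symmetric `X`, with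
equality attained at some nonzero symmetric `X`; that is, the operator norm of `L_A`
with respect to the spectral `p`-norm equals `‖A‖_∞`. -/
theorem lyapunov_operator_norm {n : ℕ} (hn : 0 < n)
    (A : Matrix (Fin n) (Fin n) ℝ) (hA : A.IsHermitian) (p : ℝ) (hp : 1 ≤ p) :
    (∀ X : Matrix (Fin n) (Fin n) ℝ, ∀ hX : X.IsHermitian,
      ∀ hJ : ((1 / 2 : ℝ) • (A * X + X * A)).IsHermitian,
        spectralPNorm p hJ ≤ spectralSupNorm hA * spectralPNorm p hX) ∧
    (∃ X : Matrix (Fin n) (Fin n) ℝ, ∃ hX : X.IsHermitian,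
      ∃ hJ : ((1 / 2 : ℝ) • (A * X + X * A)).IsHermitian, X ≠ 0 ∧
        spectralPNorm p hJ = spectralSupNorm hA * spectralPNorm p hX) := by
  refine ⟨fun X hX hJ => hA.spectralPNorm_lyapunov_le hX hJ rfl hp hA.spectralSupNorm_nonneg
    hA.norm_toEuclideanLin_le, ?_⟩
  have : Nonempty (Fin n) := ⟨⟨0, hn⟩⟩
  obtain ⟨k, hk⟩ := exists_eq_ciSup_of_finite (f := fun i => |hA.eigenvalues i|)
  set u : Fin n → ℝ := ⇑(hA.eigenvectorBasis k)
  have hu : A *ᵥ u = hA.eigenvalues k • u := hA.mulVec_eigenvectorBasis k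
  have hu' : u ᵥ* A = hA.eigenvalues k • u := by
    rw [← hu, ← mulVec_transpose, ← conjTranspose_eq_transpose_of_trivial, hA.eq]
  have hX : (vecMulVec u u).IsHermitian := by
    ext i j
    simp [vecMulVec_apply, mul_comm]
  have hJX : (1 / 2 : ℝ) • (A * vecMulVec u u + vecMulVec u u * A) =
      hA.eigenvalues k • vecMulVec u u := by
    rw [mul_vecMulVec, vecMulVec_mul, hu, hu', smul_vecMulVec, vecMulVec_smul, ← two_smul ℝ,
      smul_smul]
    norm_num
  have hJ : ((1 / 2 : ℝ) • (A * vecMulVec u u + vecMulVec u u * A)).IsHermitian := by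
    rw [hJX, Matrix.IsHermitian, conjTranspose_smul, hX.eq, star_trivial]
  have hu0 : u ≠ 0 := fun h0 =>
    hA.eigenvectorBasis.toBasis.ne_zero k (by ext i; simpa using congrFun h0 i)
  refine ⟨vecMulVec u u, hX, hJ, by simpa [vecMulVec_eq_zero] using hu0, le_antisymm ?_ ?_⟩
  · exact hA.spectralPNorm_lyapunov_le hX hJ rfl hp hA.spectralSupNorm_nonneg
      hA.norm_toEuclideanLin_le
  · rw [spectralSupNorm, ← hk]
    exact hX.abs_mul_spectralPNorm_le hJ hJX hp
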